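/- SLLN (exponential concentration form) for the mean-field approximated clique density (Theorem 3.11, first part): Fix an integer ℓ ≥ 3 and set C = ℓ(ℓ−1)/2. Assume α > −2 and that g_{α,h} attains its maximum over [0,1] at a unique point u₀* ∈ (0,1). Then for every ε > 0 there exist τ > 0 and N ∈ ℕ such that for all n ≥ N, ℙ̄_{n;α,h}( { m ∈ Γ_n : |m^C − (u₀*)^C| ≥ ε } ) ≤ exp(−τ·n²); in particular ℓ!·K̄_n/n^ℓ = m^C converges almost surely to (u₀*)^C. -/

import Mathlib

open scoped Classical
open Filter MeasureTheory

/-- The edge density `2k/n²` corresponding to `k` edges out of `n(n−1)/2`. -/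
noncomputable def mfDensity (n k : ℕ) : ℝ := 2 * k / (n : ℝ) ^ 2

/-- Mean-field Gibbs weight `𝒩_m · exp(n²((α/6)m³ + (h/2)m))` for `m = 2k/n²`. -/
noncomputable def mfWeight (α h : ℝ) (n k : ℕ) : ℝ :=
  (Nat.choose (n * (n - 1) / 2) k : ℝ) *
    Real.exp ((n : ℝ) ^ 2 * (α / 6 * (mfDensity n k) ^ 3 + h / 2 * mfDensity n k))

/-- Mean-field partition function. -/
noncomputable def mfZ (α h : ℝ) (n : ℕ) : ℝ :=
  ∑ k ∈ Finset.range (n * (n - 1) / 2 + 1), mfWeight α h n k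

/-- Expectation of `f(m)` under the mean-field Gibbs measure on edge densities `Γ_n`. -/
noncomputable def mfExp (α h : ℝ) (n : ℕ) (f : ℝ → ℝ) : ℝ :=
  (∑ k ∈ Finset.range (n * (n - 1) / 2 + 1), f (mfDensity n k) * mfWeight α h n k) /
    mfZ α h n

/-- Probability of the event `{m ∈ Γ_n : m ∈ A}` under the mean-field Gibbs measure. -/
noncomputable def mfProb (α h : ℝ) (n : ℕ) (A : Set ℝ) : ℝ :=
  (∑ k ∈ Finset.range (n * (n - 1) / 2 + 1),
      if mfDensity n k ∈ A then mfWeight α h n k else 0) / mfZ α h n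

/-- The energy function `g_{α,h}(u) = (α/6)u³ + (h/2)u − I(u)/2`
(note `Real.log 0 = 0`, so the boundary convention `I(0)=I(1)=0` is automatic). -/
noncomputable def gFun (α h u : ℝ) : ℝ :=
  α / 6 * u ^ 3 + h / 2 * u - (u * Real.log u + (1 - u) * Real.log (1 - u)) / 2

lemma cast_mul_pred_div_two (n : ℕ) : ((n * (n - 1) / 2 : ℕ) : ℝ) = ((n : ℝ) ^ 2 - n) / 2 := by
  rw [Nat.cast_div (Nat.even_mul_pred_self n).two_dvd (by norm_num)]
  rcases n with _ | n
  · simp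
  · push_cast [Nat.add_sub_cancel]; ring

lemma continuous_gFun (α h : ℝ) : Continuous (gFun α h) := by
  unfold gFun
  have h1 : Continuous fun u : ℝ => (1 - u) * Real.log (1 - u) :=
    Real.continuous_mul_log.comp (continuous_const.sub continuous_id)
  have h2 := Real.continuous_mul_log
  fun_prop

lemma choose_mul_pow_mul_pow_le_one (N k : ℕ) (hk : k ≤ N) {p : ℝ} (hp0 : 0 ≤ p) (hp1 : p ≤ 1) :
    (N.choose k : ℝ) * (p ^ k * (1 - p) ^ (N - k)) ≤ 1 := by
  have hsum : ∑ j ∈ Finset.range (N + 1), p ^ j * (1 - p) ^ (N - j) * (N.choose j : ℝ) = 1 := by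
    rw [← add_pow, add_sub_cancel, one_pow]
  have hq : 0 ≤ 1 - p := by linarith
  rw [mul_comm]
  refine le_of_le_of_eq ?_ hsum
  exact Finset.single_le_sum
    (f := fun j => p ^ j * (1 - p) ^ (N - j) * (N.choose j : ℝ))
    (fun j _ => by positivity) (Finset.mem_range_succ_iff.2 hk)

lemma pow_mul_pow_eq_exp (N k : ℕ) (hk : k ≤ N) {p : ℝ} (hp : p ∈ Set.Ioo (0 : ℝ) 1) :
    p ^ k * (1 - p) ^ (N - k) =
      Real.exp (k * Real.log p + ((N : ℝ) - k) * Real.log (1 - p)) := by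
  rw [Real.exp_add, ← Nat.cast_sub hk, Real.exp_nat_mul, Real.exp_nat_mul, Real.exp_log hp.1,
    Real.exp_log (by linarith [hp.2])]

lemma sq_mul_mfDensity {n : ℕ} (hn : n ≠ 0) (k : ℕ) : (n : ℝ) ^ 2 * mfDensity n k = 2 * k := by
  unfold mfDensity
  field_simp

lemma mfDensity_mem_Ico {n k : ℕ} (hn : n ≠ 0) (hk : k ≤ n * (n - 1) / 2) :
    mfDensity n k ∈ Set.Ico (0 : ℝ) 1 := by
  have hn' : (0 : ℝ) < n := by positivity
  have hk' : (k : ℝ) ≤ ((n : ℝ) ^ 2 - n) / 2 := by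
    rw [← cast_mul_pred_div_two]; exact_mod_cast hk
  refine ⟨by unfold mfDensity; positivity, ?_⟩
  unfold mfDensity
  rw [div_lt_one (by positivity)]
  linarith

/-- The Gibbs weight is bounded by the exponential of the energy, without any error term. -/
lemma mfWeight_le_exp_gFun (α h : ℝ) {n k : ℕ} (hn : n ≠ 0) (hk : k ≤ n * (n - 1) / 2) :
    mfWeight α h n k ≤ Real.exp ((n : ℝ) ^ 2 * gFun α h (mfDensity n k)) := by
  have hn' : (0 : ℝ) < n := by positivity
  rcases Nat.eq_zero_or_pos k with rfl | hkpos
  · simp [mfWeight, mfDensity, gFun]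
  have hm := mfDensity_mem_Ico hn hk
  have hmk := sq_mul_mfDensity hn k
  have hm0 : 0 < mfDensity n k := by unfold mfDensity; positivity
  set m := mfDensity n k
  have hbound := choose_mul_pow_mul_pow_le_one _ k hk hm.1 hm.2.le
  rw [pow_mul_pow_eq_exp _ k hk ⟨hm0, hm.2⟩, cast_mul_pred_div_two] at hbound
  have hlog : Real.log (1 - m) ≤ 0 := Real.log_nonpos (by linarith [hm.2]) (by linarith)
  set L := k * Real.log m + (((n : ℝ) ^ 2 - n) / 2 - k) * Real.log (1 - m) with hL
  have hchoose : ((n * (n - 1) / 2).choose k : ℝ) ≤ Real.exp (-L) := by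
    rw [Real.exp_neg, ← one_div, le_div_iff₀ (Real.exp_pos _)]
    exact hbound
  calc mfWeight α h n k
      ≤ Real.exp (-L) * Real.exp ((n : ℝ) ^ 2 * (α / 6 * m ^ 3 + h / 2 * m)) :=
        mul_le_mul_of_nonneg_right hchoose (Real.exp_pos _).le
    _ ≤ Real.exp ((n : ℝ) ^ 2 * gFun α h m) := by
        rw [← Real.exp_add, Real.exp_le_exp]
        have hk2 : (k : ℝ) = (n : ℝ) ^ 2 * m / 2 := by linarith
        have : (n : ℝ) ^ 2 * gFun α h m -
            (-L + (n : ℝ) ^ 2 * (α / 6 * m ^ 3 + h / 2 * m)) = -(n / 2 * Real.log (1 - m)) := by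
          rw [hL, hk2, gFun]; ring
        nlinarith

lemma mfWeight_nonneg (α h : ℝ) (n k : ℕ) : 0 ≤ mfWeight α h n k := by
  unfold mfWeight; positivity

/-- Chebyshev's inequality for the binomial distribution, as a weighted sum. -/
lemma one_sub_variance_le_sum_binomial (N : ℕ) (hN : N ≠ 0) {p δ : ℝ} (hp : p ∈ Set.Icc (0 : ℝ) 1)
    (hδ : 0 < δ) :
    1 - 1 / (N * δ ^ 2) ≤ ∑ k ∈ Finset.range (N + 1),
      (N.choose k : ℝ) * (p ^ k * (1 - p) ^ (N - k)) * (1 - ((p - k / N) / δ) ^ 2) := by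
  have hvar := bernstein.variance (n := N) (Nat.cast_ne_zero.2 hN) ⟨p, hp⟩
  have hone := bernstein.probability N ⟨p, hp⟩
  simp only [bernstein_apply, bernstein.z] at hvar hone
  rw [Fin.sum_univ_eq_sum_range
    (fun k => (p - (k : ℝ) / N) ^ 2 * ((N.choose k : ℝ) * p ^ k * (1 - p) ^ (N - k)))] at hvar
  rw [Fin.sum_univ_eq_sum_range
    (fun k => (N.choose k : ℝ) * p ^ k * (1 - p) ^ (N - k))] at hone
  have hN' : (0 : ℝ) < N := by positivity
  have hkey : ∑ k ∈ Finset.range (N + 1),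
      (N.choose k : ℝ) * (p ^ k * (1 - p) ^ (N - k)) * (1 - ((p - k / N) / δ) ^ 2) =
      1 - p * (1 - p) / N / δ ^ 2 := by
    rw [← hvar, Finset.sum_div]
    nth_rewrite 3 [← hone]
    rw [← Finset.sum_sub_distrib]
    exact Finset.sum_congr rfl fun k _ => by rw [div_pow]; ring
  rw [hkey, div_div]
  gcongr
  nlinarith [hp.1, hp.2]

/-- Lower bound on the partition function, up to a subexponential factor. -/
lemma exists_le_mfZ (α h : ℝ) {p : ℝ} (hp : p ∈ Set.Ioo (0 : ℝ) 1) {η : ℝ} (hη : 0 < η) :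
    ∃ N₀ : ℕ, ∀ n ≥ N₀, 1 / 2 *
      Real.exp ((n : ℝ) ^ 2 * (gFun α h p - η) + n / 2 * Real.log (1 - p)) ≤ mfZ α h n := by
  set G : ℝ → ℝ := fun m =>
    α / 6 * m ^ 3 + h / 2 * m - (m * Real.log p + (1 - m) * Real.log (1 - p)) / 2 with hG
  have hGcont : Continuous G := by fun_prop
  obtain ⟨δ, hδ, hGδ⟩ := Metric.continuous_iff.1 hGcont p η hη
  have hlarge : ∀ᶠ n : ℕ in atTop, 2 ≤ n ∧ 2 / δ ≤ (n : ℝ) ∧ 32 / δ ^ 2 ≤ (n : ℝ) :=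
    (eventually_ge_atTop 2).and ((tendsto_natCast_atTop_atTop.eventually_ge_atTop _).and
      (tendsto_natCast_atTop_atTop.eventually_ge_atTop _))
  obtain ⟨N₀, hN₀⟩ := eventually_atTop.1 hlarge
  refine ⟨N₀, fun n hn => ?_⟩
  obtain ⟨hn2, hnδ, hnδ2⟩ := hN₀ n hn
  have hn0 : n ≠ 0 := by omega
  have hn2' : (2 : ℝ) ≤ n := by exact_mod_cast hn2
  have hn' : (0 : ℝ) < n := by linarith
  have hNcast := cast_mul_pred_div_two n
  unfold mfZ mfWeight
  set N := n * (n - 1) / 2 with hNdef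
  have hNn : (n : ℝ) / 2 ≤ N := by rw [hNcast]; nlinarith
  have hNpos : (0 : ℝ) < N := by linarith
  have hN0 : N ≠ 0 := by intro h0; simp [h0] at hNpos
  have hcheb := one_sub_variance_le_sum_binomial N hN0 (δ := δ / 2)
    (Set.Ioo_subset_Icc_self hp) (by positivity)
  set E := Real.exp ((n : ℝ) ^ 2 * (gFun α h p - η) + n / 2 * Real.log (1 - p)) with hE
  have hhalf : (1 : ℝ) / 2 ≤ 1 - 1 / (N * (δ / 2) ^ 2) := by
    rw [div_le_iff₀ (by positivity)] at hnδ2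
    have : 1 / (N * (δ / 2) ^ 2) ≤ (1 : ℝ) / 2 := by
      rw [div_le_div_iff₀ (by positivity) (by norm_num)]
      nlinarith [sq_nonneg δ]
    linarith
  calc 1 / 2 * E ≤ (∑ k ∈ Finset.range (N + 1), (N.choose k : ℝ) * (p ^ k * (1 - p) ^ (N - k)) *
        (1 - ((p - k / N) / (δ / 2)) ^ 2)) * E :=
        mul_le_mul_of_nonneg_right (hhalf.trans hcheb) (Real.exp_pos _).le
    _ ≤ _ := by
        rw [Finset.sum_mul]
        refine Finset.sum_le_sum fun k hk => ?_
        have hk' : k ≤ N := Finset.mem_range_succ_iff.1 hk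
        have hkN : (k : ℝ) / N ≤ 1 := by
          rw [div_le_one hNpos]; exact_mod_cast hk'
        have hkN0 : 0 ≤ (k : ℝ) / N := by positivity
        rw [mul_assoc, mul_assoc]
        refine mul_le_mul_of_nonneg_left ?_ (by positivity)
        rw [pow_mul_pow_eq_exp N k hk' hp]
        rcases lt_or_ge |p - k / N| (δ / 2) with hlt | hge
        · have hcoef : 1 - ((p - k / N) / (δ / 2)) ^ 2 ≤ 1 := by
            linarith [sq_nonneg ((p - k / N) / (δ / 2))]
          have hdist : dist (mfDensity n k) p < δ := by
            have hmk : mfDensity n k = k / N - k / N / n := by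
              have hn1 : (n : ℝ) - 1 ≠ 0 := by linarith
              have : (N : ℝ) = n * (n - 1) / 2 := by rw [hNcast]; ring
              rw [mfDensity, this]
              field_simp
            have hsmall : k / N / n ≤ δ / 2 := by
              rw [div_le_iff₀ hδ] at hnδ
              rw [div_le_iff₀ hn']
              linarith
            have : 0 ≤ (k : ℝ) / N / n := by positivity
            rw [abs_lt] at hlt
            rw [Real.dist_eq, hmk, abs_lt]
            constructor <;> linarith
          have hGm := hGδ _ hdist
          rw [Real.dist_eq, abs_lt] at hGm
          have hGp : G p = gFun α h p := rfl
          have hk2 : (k : ℝ) = (n : ℝ) ^ 2 * mfDensity n k / 2 := by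
            linarith [sq_mul_mfDensity hn0 k]
          calc _ ≤ Real.exp (k * Real.log p + ((N : ℝ) - k) * Real.log (1 - p)) * (1 * E) := by
                gcongr
            _ ≤ _ := by
                rw [one_mul, hE, ← Real.exp_add, Real.exp_le_exp, hNcast]
                have : (n : ℝ) ^ 2 * (gFun α h p - η) ≤ (n : ℝ) ^ 2 * G (mfDensity n k) := by
                  gcongr; linarith
                refine (add_le_add_right (add_le_add_left this _) _).trans (le_of_eq ?_)
                simp only [hG]
                rw [hk2]
                ring_nf
        · have hcoef : 1 - ((p - k / N) / (δ / 2)) ^ 2 ≤ 0 := by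
            rw [sub_nonpos, div_pow, le_div_iff₀ (by positivity), one_mul, ← sq_abs (p - k / N)]
            gcongr
          refine le_trans ?_ (Real.exp_pos _).le
          exact mul_nonpos_of_nonneg_of_nonpos (Real.exp_pos _).le
            (mul_nonpos_of_nonpos_of_nonneg hcoef (Real.exp_pos _).le)

/-- If the energy is bounded away from `gFun α h p` on a set, that set has exponentially small
probability. -/
lemma exists_mfProb_le_exp (α h : ℝ) {p : ℝ} (hp : p ∈ Set.Ioo (0 : ℝ) 1) {τ : ℝ} (hτ : 0 < τ)
    {A : Set ℝ} (hA : ∀ u ∈ Set.Icc (0 : ℝ) 1, u ∈ A → gFun α h u ≤ gFun α h p - 4 * τ) :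
    ∃ N₀ : ℕ, ∀ n ≥ N₀, mfProb α h n A ≤ Real.exp (-τ * (n : ℝ) ^ 2) := by
  obtain ⟨N₁, hZ⟩ := exists_le_mfZ α h hp hτ
  set c := -Real.log (1 - p) with hc
  obtain ⟨N₂, hN₂⟩ := eventually_atTop.1
    (tendsto_natCast_atTop_atTop.eventually_ge_atTop (max (4 / τ) (c / (2 * τ))))
  refine ⟨max 2 (max N₁ N₂), fun n hn => ?_⟩
  simp only [ge_iff_le, max_le_iff] at hn
  obtain ⟨hn2, hn1, hnN₂⟩ := hn
  have hnτ := hN₂ n hnN₂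
  rw [max_le_iff, div_le_iff₀ hτ, div_le_iff₀ (by positivity)] at hnτ
  have hn0 : n ≠ 0 := by omega
  have hn2' : (2 : ℝ) ≤ n := by exact_mod_cast hn2
  have hZn := hZ n hn1
  have hZpos : 0 < mfZ α h n := lt_of_lt_of_le (by positivity) hZn
  unfold mfProb
  rw [div_le_iff₀ hZpos]
  have hnum : (∑ k ∈ Finset.range (n * (n - 1) / 2 + 1),
      if mfDensity n k ∈ A then mfWeight α h n k else 0) ≤
      (n : ℝ) ^ 2 / 2 * Real.exp ((n : ℝ) ^ 2 * (gFun α h p - 4 * τ)) := by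
    calc _ ≤ ∑ k ∈ Finset.range (n * (n - 1) / 2 + 1),
          Real.exp ((n : ℝ) ^ 2 * (gFun α h p - 4 * τ)) := by
          refine Finset.sum_le_sum fun k hk => ?_
          have hk' : k ≤ n * (n - 1) / 2 := Finset.mem_range_succ_iff.1 hk
          split_ifs with hkA
          · refine (mfWeight_le_exp_gFun α h hn0 hk').trans (Real.exp_le_exp.2 ?_)
            gcongr
            exact hA _ (Set.Ico_subset_Icc_self (mfDensity_mem_Ico hn0 hk')) hkA
          · positivity
      _ ≤ _ := by
          rw [Finset.sum_const, Finset.card_range, nsmul_eq_mul]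
          gcongr
          push_cast [cast_mul_pred_div_two]
          linarith
  refine hnum.trans (le_trans ?_ (mul_le_mul_of_nonneg_left hZn (Real.exp_pos _).le))
  have hpoly : (n : ℝ) ^ 2 ≤ Real.exp (τ * (n : ℝ) ^ 2) := by
    have h1 : (n : ℝ) ≤ Real.exp n := by linarith [Real.add_one_le_exp (n : ℝ)]
    calc (n : ℝ) ^ 2 ≤ Real.exp n ^ 2 := by gcongr
      _ = Real.exp (2 * n) := by rw [← Real.exp_nat_mul]; norm_num
      _ ≤ _ := by
          rw [Real.exp_le_exp]; nlinarith
  calc (n : ℝ) ^ 2 / 2 * Real.exp ((n : ℝ) ^ 2 * (gFun α h p - 4 * τ))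
      ≤ 1 / 2 * (Real.exp (τ * (n : ℝ) ^ 2) *
          Real.exp ((n : ℝ) ^ 2 * (gFun α h p - 4 * τ))) := by
        rw [← mul_assoc, div_eq_inv_mul, ← one_div]
        gcongr
    _ ≤ 1 / 2 * (Real.exp (-τ * (n : ℝ) ^ 2) *
          Real.exp ((n : ℝ) ^ 2 * (gFun α h p - τ) + n / 2 * Real.log (1 - p))) := by
        rw [← Real.exp_add, ← Real.exp_add]
        refine mul_le_mul_of_nonneg_left (Real.exp_le_exp.2 ?_) (by norm_num)
        have := mul_le_mul_of_nonneg_left hnτ.2 (show (0 : ℝ) ≤ n by positivity)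
        linarith
    _ = _ := by ring

/-- On a closed set avoiding the unique maximizer, the energy stays away from its maximum. -/
lemma exists_gFun_le_sub {α h u₀ : ℝ}
    (hmax : ∀ u ∈ Set.Icc (0 : ℝ) 1, gFun α h u ≤ gFun α h u₀)
    (huniq : ∀ u ∈ Set.Icc (0 : ℝ) 1, gFun α h u = gFun α h u₀ → u = u₀)
    {A : Set ℝ} (hA : IsClosed A) (hu₀A : u₀ ∉ A) :
    ∃ τ > 0, ∀ u ∈ Set.Icc (0 : ℝ) 1, u ∈ A → gFun α h u ≤ gFun α h u₀ - 4 * τ := by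
  rcases (Set.Icc (0 : ℝ) 1 ∩ A).eq_empty_or_nonempty with hempty | hne
  · exact ⟨1, one_pos, fun u hu huA => absurd ⟨hu, huA⟩ (Set.eq_empty_iff_forall_notMem.1 hempty u)⟩
  obtain ⟨u₁, ⟨hu₁, hu₁A⟩, hu₁max⟩ :=
    (isCompact_Icc.inter_right hA).exists_isMaxOn hne (continuous_gFun α h).continuousOn
  have hlt : gFun α h u₁ < gFun α h u₀ :=
    (hmax u₁ hu₁).lt_of_ne fun heq => hu₀A (huniq u₁ hu₁ heq ▸ hu₁A)
  refine ⟨(gFun α h u₀ - gFun α h u₁) / 4, by linarith, fun u hu huA => ?_⟩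
  have : gFun α h u ≤ gFun α h u₁ := hu₁max ⟨hu, huA⟩
  linarith

/-- Exponential concentration for the mean-field approximated clique density
`m^C` with `C = ℓ(ℓ−1)/2`, in the uniqueness regime. -/
theorem meanField_clique_exponential_concentration_unique_maximizer
    (ℓ : ℕ) (hℓ : 3 ≤ ℓ)
    (α h : ℝ) (hα : α > -2) (u₀ : ℝ) (hu₀ : u₀ ∈ Set.Ioo (0 : ℝ) 1)
    (hmax : ∀ u ∈ Set.Icc (0 : ℝ) 1, gFun α h u ≤ gFun α h u₀)
    (huniq : ∀ u ∈ Set.Icc (0 : ℝ) 1, gFun α h u = gFun α h u₀ → u = u₀) :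
    ∀ ε > 0, ∃ τ > 0, ∃ N : ℕ, ∀ n ≥ N,
      mfProb α h n {m : ℝ | ε ≤ |m ^ (ℓ * (ℓ - 1) / 2) - u₀ ^ (ℓ * (ℓ - 1) / 2)|} ≤
        Real.exp (-τ * (n : ℝ) ^ 2) := by
  intro ε hε
  have hclosed : IsClosed
      {m : ℝ | ε ≤ |m ^ (ℓ * (ℓ - 1) / 2) - u₀ ^ (ℓ * (ℓ - 1) / 2)|} :=
    isClosed_le continuous_const (by fun_prop)
  obtain ⟨τ, hτ, hgap⟩ := exists_gFun_le_sub hmax huniq hclosed (by simpa using hε)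
  exact ⟨τ, hτ, exists_mfProb_le_exp α h hu₀ hτ hgap⟩
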